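/- arXiv:2312.00025 — 4 statements merged into one kernel-verified Lean document; each statement's English description precedes it below -/
import Mathlib

section
/- The self-attention sub-block with transformed weights is column-permutation equivariant. Let x ∈ ℝ^{n×d}, weights W_q, W_k, W_v, W_o ∈ ℝ^{d×d}, mask M ∈ ℝ^{n×n}, constant k > 0, and d×d permutation matrices π, π₁, π₂. Define Q = xW_q, K = xW_k, V = xW_v, and u = SoftMax(QKᵀ/√k + M) V W_o. Define the transformed weights W_q' = πᵀW_qπ₁, W_k' = πᵀW_kπ₁, W_v' = πᵀW_vπ₂, W_o' = π₂ᵀW_oπ, and let u' be the analogous output computed from the input xπ with the transformed weights, i.e. u' = SoftMax((xπ W_q')(xπ W_k')ᵀ/√k + M)(xπ W_v')W_o'. Then u' = uπ. -/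
open Matrix

noncomputable section

/-- The `d × d` real permutation matrix of a permutation `σ`, with `π i j = 1` iff `σ i = j`. -/
def permMatrix {d : ℕ} (σ : Equiv.Perm (Fin d)) : Matrix (Fin d) (Fin d) ℝ :=
  Matrix.of fun i j => if σ i = j then (1 : ℝ) else 0

/-- Row-wise SoftMax: `SoftMax(z)_{ij} = exp(z_{ij}) / Σ_k exp(z_{ik})`. -/
def softmax {n m : ℕ} (z : Matrix (Fin n) (Fin m) ℝ) : Matrix (Fin n) (Fin m) ℝ :=
  Matrix.of fun i j => Real.exp (z i j) / ∑ k, Real.exp (z i k)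

theorem permMatrix_mul_transpose {d : ℕ} (σ : Equiv.Perm (Fin d)) :
    permMatrix σ * (permMatrix σ)ᵀ = 1 := by
  ext i j
  simp [permMatrix, Matrix.mul_apply, Matrix.one_apply, eq_comm]

/-- Inserting a permutation before a matrix and its inverse into that matrix changes nothing. -/
theorem mul_permMatrix_mul_transpose_mul_mul {n d : ℕ} (σ : Equiv.Perm (Fin d))
    (x : Matrix (Fin n) (Fin d) ℝ) (W P : Matrix (Fin d) (Fin d) ℝ) :
    x * permMatrix σ * ((permMatrix σ)ᵀ * W * P) = x * W * P := by
  rw [Matrix.mul_assoc (permMatrix σ)ᵀ, Matrix.mul_assoc x, ← Matrix.mul_assoc (permMatrix σ),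
    permMatrix_mul_transpose, Matrix.one_mul, ← Matrix.mul_assoc]

/-- Multiplying queries and keys by the same permutation preserves the attention scores. -/
theorem mul_permMatrix_mul_transpose {m n d : ℕ} (σ : Equiv.Perm (Fin d))
    (Q : Matrix (Fin m) (Fin d) ℝ) (K : Matrix (Fin n) (Fin d) ℝ) :
    Q * permMatrix σ * (K * permMatrix σ)ᵀ = Q * Kᵀ := by
  rw [Matrix.transpose_mul, Matrix.mul_assoc, ← Matrix.mul_assoc (permMatrix σ),
    permMatrix_mul_transpose, Matrix.one_mul]

/-- The self-attention sub-block with transformed weights is column-permutation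
equivariant: with `W_q' = πᵀW_qπ₁`, `W_k' = πᵀW_kπ₁`, `W_v' = πᵀW_vπ₂`,
`W_o' = π₂ᵀW_oπ`, the output `u'` computed from input `xπ` equals `uπ`. -/
theorem self_attention_transformed_equivariant {n d : ℕ}
    (x : Matrix (Fin n) (Fin d) ℝ) (Wq Wk Wv Wo : Matrix (Fin d) (Fin d) ℝ)
    (M : Matrix (Fin n) (Fin n) ℝ) (k : ℝ) (hk : 0 < k)
    (σ σ₁ σ₂ : Equiv.Perm (Fin d)) :
    let π := permMatrix σ
    let π₁ := permMatrix σ₁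
    let π₂ := permMatrix σ₂
    let Q := x * Wq
    let K := x * Wk
    let V := x * Wv
    let u := softmax ((Real.sqrt k)⁻¹ • (Q * Kᵀ) + M) * V * Wo
    let Wq' := πᵀ * Wq * π₁
    let Wk' := πᵀ * Wk * π₁
    let Wv' := πᵀ * Wv * π₂
    let Wo' := π₂ᵀ * Wo * π
    let u' := softmax ((Real.sqrt k)⁻¹ •
        ((x * π * Wq') * (x * π * Wk')ᵀ) + M) * (x * π * Wv') * Wo'
    u' = u * π := by
  intro π π₁ π₂ Q K V u Wq' Wk' Wv' Wo' u'
  simp only [u', u, Q, K, V, Wq', Wk', Wv', Wo', π, π₁, π₂,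
    mul_permMatrix_mul_transpose_mul_mul, mul_permMatrix_mul_transpose]
  rw [← Matrix.mul_assoc _ (x * Wv), mul_permMatrix_mul_transpose_mul_mul]
end
end

section
/- The classifier head with transformed weight permutes its output: for y ∈ ℝ^{n×d}, classifier weight W_c ∈ ℝ^{d×s}, a d×d permutation matrix π, and an s×s permutation matrix π_c, one has SoftMax((yπ)(πᵀW_cπ_c)) = SoftMax(yW_c)π_c. -/
open Matrix

noncomputable section

theorem mul_permMatrix_apply {n d : ℕ} (A : Matrix (Fin n) (Fin d) ℝ)
    (σ : Equiv.Perm (Fin d)) (i : Fin n) (j : Fin d) :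
    (A * permMatrix σ) i j = A i (σ.symm j) := by
  simp [Matrix.mul_apply, permMatrix, ← Equiv.eq_symm_apply]

theorem softmax_mul_permMatrix {n m : ℕ} (z : Matrix (Fin n) (Fin m) ℝ)
    (σ : Equiv.Perm (Fin m)) :
    softmax (z * permMatrix σ) = softmax z * permMatrix σ := by
  ext i j
  simp only [mul_permMatrix_apply, softmax, Matrix.of_apply]
  rw [Equiv.sum_comp σ.symm fun k => Real.exp (z i k)]

/-- The classifier head with transformed weight permutes its output:
`SoftMax((yπ)(πᵀW_cπ_c)) = SoftMax(yW_c)π_c`. -/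
theorem classifier_transformed_perm {n d s : ℕ}
    (y : Matrix (Fin n) (Fin d) ℝ) (Wc : Matrix (Fin d) (Fin s) ℝ)
    (σ : Equiv.Perm (Fin d)) (σc : Equiv.Perm (Fin s)) :
    softmax ((y * permMatrix σ) * ((permMatrix σ)ᵀ * Wc * permMatrix σc)) =
      softmax (y * Wc) * permMatrix σc := by
  rw [← softmax_mul_permMatrix, Matrix.mul_assoc (permMatrix σ)ᵀ, Matrix.mul_assoc y,
    ← Matrix.mul_assoc (permMatrix σ), permMatrix_mul_transpose, Matrix.one_mul,
    ← Matrix.mul_assoc]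
end
end

section
/- A Pre-LayerNorm Transformer layer with transformed parameters is column-permutation equivariant. Fix x ∈ ℝ^{n×d}, attention weights W_q, W_k, W_v, W_o ∈ ℝ^{d×d}, mask M ∈ ℝ^{n×n}, constant k > 0, feedforward weights W₁ ∈ ℝ^{d×m}, W₂ ∈ ℝ^{m×d}, and LayerNorm weights γ₁, β₁, γ₂, β₂ ∈ ℝ^d. Define Attn(w) = SoftMax((wW_q)(wW_k)ᵀ/√k + M)(wW_v)W_o, v = Attn(LayerNorm(x; γ₁, β₁)) + x, and y = ReLU(LayerNorm(v; γ₂, β₂) W₁)W₂ + v. Given d×d permutation matrices π, π₁, π₂ and an m×m permutation matrix π₃, define the transformed layer by replacing W_q with πᵀW_qπ₁, W_k with πᵀW_kπ₁, W_v with πᵀW_vπ₂, W_o with π₂ᵀW_oπ, W₁ with πᵀW₁π₃, W₂ with π₃ᵀW₂π, γ₁ with γ₁π, β₁ with β₁π, γ₂ with γ₂π, β₂ with β₂π, and let v', y' denote the corresponding quantities computed from the input xπ. Then v' = vπ and y' = yπ. -/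
open Matrix

noncomputable section

/-- Mean of row `i` of `x`: `μ_i = (1/d) Σ_j x_{ij}`. -/
def rowMean {n d : ℕ} (x : Matrix (Fin n) (Fin d) ℝ) (i : Fin n) : ℝ :=
  (∑ j, x i j) / d

/-- Standard deviation of row `i` of `x`: `σ_i = sqrt((1/d) Σ_j (x_{ij} − μ_i)²)`. -/
def rowStd {n d : ℕ} (x : Matrix (Fin n) (Fin d) ℝ) (i : Fin n) : ℝ :=
  Real.sqrt ((∑ j, (x i j - rowMean x i) ^ 2) / d)

/-- LayerNorm with weights `γ, β`:
`LayerNorm(x; γ, β)_{ij} = γ_j · (x_{ij} − μ_i)/σ_i + β_j`. -/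
def layerNorm {n d : ℕ} (x : Matrix (Fin n) (Fin d) ℝ) (γ β : Fin d → ℝ) :
    Matrix (Fin n) (Fin d) ℝ :=
  Matrix.of fun i j => γ j * ((x i j - rowMean x i) / rowStd x i) + β j

/-- ReLU applied entrywise to a matrix: `ReLU(t) = max(t, 0)`. -/
def reluMat {n m : ℕ} (x : Matrix (Fin n) (Fin m) ℝ) : Matrix (Fin n) (Fin m) ℝ :=
  Matrix.of fun i j => max (x i j) 0

theorem permMatrix_mul_transpose_mul {d m : ℕ} (σ : Equiv.Perm (Fin d))
    (A : Matrix (Fin d) (Fin m) ℝ) : permMatrix σ * ((permMatrix σ)ᵀ * A) = A := by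
  rw [← Matrix.mul_assoc, permMatrix_mul_transpose, Matrix.one_mul]

theorem vecMul_permMatrix {d : ℕ} (v : Fin d → ℝ) (σ : Equiv.Perm (Fin d)) :
    v ᵥ* permMatrix σ = v ∘ σ.symm := by
  ext j
  simp [permMatrix, Matrix.vecMul, dotProduct, ← Equiv.eq_symm_apply]

theorem mul_permMatrix {n d : ℕ} (x : Matrix (Fin n) (Fin d) ℝ) (σ : Equiv.Perm (Fin d)) :
    x * permMatrix σ = x.submatrix id σ.symm := by
  ext i j
  simp [permMatrix, Matrix.mul_apply, ← Equiv.eq_symm_apply]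

theorem rowMean_submatrix {n d : ℕ} (x : Matrix (Fin n) (Fin d) ℝ) (σ : Equiv.Perm (Fin d)) :
    rowMean (x.submatrix id σ) = rowMean x := by
  ext i
  simp [rowMean, Equiv.sum_comp σ (x i)]

theorem rowStd_submatrix {n d : ℕ} (x : Matrix (Fin n) (Fin d) ℝ) (σ : Equiv.Perm (Fin d)) :
    rowStd (x.submatrix id σ) = rowStd x := by
  ext i
  simp [rowStd, rowMean_submatrix, Equiv.sum_comp σ fun j => (x i j - rowMean x i) ^ 2]

theorem layerNorm_mul_permMatrix {n d : ℕ} (x : Matrix (Fin n) (Fin d) ℝ) (γ β : Fin d → ℝ)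
    (σ : Equiv.Perm (Fin d)) :
    layerNorm (x * permMatrix σ) (γ ᵥ* permMatrix σ) (β ᵥ* permMatrix σ) =
      layerNorm x γ β * permMatrix σ := by
  ext i j
  simp [mul_permMatrix, vecMul_permMatrix, layerNorm, rowMean_submatrix, rowStd_submatrix]

theorem reluMat_mul_permMatrix {n m : ℕ} (x : Matrix (Fin n) (Fin m) ℝ)
    (σ : Equiv.Perm (Fin m)) :
    reluMat (x * permMatrix σ) = reluMat x * permMatrix σ := by
  ext i j
  simp [mul_permMatrix, reluMat]

/-- A Pre-LayerNorm Transformer layer with transformed parameters is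
column-permutation equivariant: `v' = vπ` and `y' = yπ`. -/
theorem pre_layernorm_transformed_equivariant {n d m : ℕ}
    (x : Matrix (Fin n) (Fin d) ℝ)
    (Wq Wk Wv Wo : Matrix (Fin d) (Fin d) ℝ)
    (M : Matrix (Fin n) (Fin n) ℝ) (k : ℝ) (hk : 0 < k)
    (W₁ : Matrix (Fin d) (Fin m) ℝ) (W₂ : Matrix (Fin m) (Fin d) ℝ)
    (γ₁ β₁ γ₂ β₂ : Fin d → ℝ)
    (σ σ₁ σ₂ : Equiv.Perm (Fin d)) (σ₃ : Equiv.Perm (Fin m)) :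
    let π := permMatrix σ
    let π₁ := permMatrix σ₁
    let π₂ := permMatrix σ₂
    let π₃ := permMatrix σ₃
    -- original layer, with Attn(w) = SoftMax((wW_q)(wW_k)ᵀ/√k + M)(wW_v)W_o
    let attn := fun (w : Matrix (Fin n) (Fin d) ℝ) =>
      softmax ((Real.sqrt k)⁻¹ • ((w * Wq) * (w * Wk)ᵀ) + M) * (w * Wv) * Wo
    let v := attn (layerNorm x γ₁ β₁) + x
    let y := reluMat (layerNorm v γ₂ β₂ * W₁) * W₂ + v
    -- transformed layer applied to xπ
    let attn' := fun (w : Matrix (Fin n) (Fin d) ℝ) =>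
      softmax ((Real.sqrt k)⁻¹ •
          ((w * (πᵀ * Wq * π₁)) * (w * (πᵀ * Wk * π₁))ᵀ) + M) *
        (w * (πᵀ * Wv * π₂)) * (π₂ᵀ * Wo * π)
    let v' := attn' (layerNorm (x * π) (γ₁ ᵥ* π) (β₁ ᵥ* π)) + x * π
    let y' := reluMat (layerNorm v' (γ₂ ᵥ* π) (β₂ ᵥ* π) * (πᵀ * W₁ * π₃)) *
        (π₃ᵀ * W₂ * π) + v'
    v' = v * π ∧ y' = y * π := by
  intro π π₁ π₂ π₃ attn v y attn' v' y'
  have hattn (w : Matrix (Fin n) (Fin d) ℝ) : attn' (w * π) = attn w * π := by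
    simp only [attn', attn, π, π₁, π₂, Matrix.transpose_mul, Matrix.transpose_transpose,
      Matrix.mul_assoc,
      permMatrix_mul_transpose_mul]
  have hv : v' = v * π := by
    simp only [v', v, Matrix.add_mul, ← hattn]
    rw [layerNorm_mul_permMatrix]
  refine ⟨hv, ?_⟩
  have hW₁ (w : Matrix (Fin n) (Fin d) ℝ) : w * π * (πᵀ * W₁ * π₃) = w * W₁ * π₃ := by
    simp only [π, Matrix.mul_assoc, permMatrix_mul_transpose_mul]
  simp only [y', y, hv, Matrix.add_mul]
  rw [layerNorm_mul_permMatrix, hW₁, reluMat_mul_permMatrix]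
  simp only [π₃, Matrix.mul_assoc, permMatrix_mul_transpose_mul]
end
end

section
/- Masked self-attention is sequence-permutation equivariant when the mask is conjugated by the permutation: for Q, K, V ∈ ℝ^{n×d}, mask M ∈ ℝ^{n×n}, constant k > 0, and an n×n permutation matrix π_n, SoftMax((π_n Q)(π_n K)ᵀ/√k + π_n M π_nᵀ)(π_n V) = π_n (SoftMax(QKᵀ/√k + M) V). -/
open Matrix

noncomputable section

/-- Left multiplication by a permutation matrix reindexes the rows. -/
theorem permMatrix_mul {n m : ℕ} (σ : Equiv.Perm (Fin n)) (A : Matrix (Fin n) (Fin m) ℝ) :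
    permMatrix σ * A = A.submatrix σ id := by
  ext i j
  simp [permMatrix, Matrix.mul_apply]

/-- Right multiplication by a transposed permutation matrix reindexes the columns. -/
theorem mul_permMatrix_transpose {n m : ℕ} (σ : Equiv.Perm (Fin n))
    (A : Matrix (Fin m) (Fin n) ℝ) :
    A * (permMatrix σ)ᵀ = A.submatrix id σ := by
  ext i j
  simp [permMatrix, Matrix.mul_apply]

/-- SoftMax commutes with reindexing the rows arbitrarily and the columns by a permutation. -/
theorem softmax_submatrix {l n m : ℕ} (f : Fin l → Fin n) (σ : Equiv.Perm (Fin m))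
    (z : Matrix (Fin n) (Fin m) ℝ) :
    softmax (z.submatrix f σ) = (softmax z).submatrix f σ := by
  ext i j
  simp [softmax, Equiv.sum_comp σ fun x => Real.exp (z (f i) x)]

/-- Masked self-attention is sequence-permutation equivariant when the mask is
conjugated by the permutation:
`SoftMax((πₙQ)(πₙK)ᵀ/√k + πₙMπₙᵀ)(πₙV) = πₙ(SoftMax(QKᵀ/√k + M)V)`. -/
theorem masked_attention_seq_perm_equivariant {n d : ℕ}
    (Q K V : Matrix (Fin n) (Fin d) ℝ) (M : Matrix (Fin n) (Fin n) ℝ)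
    (k : ℝ) (hk : 0 < k) (σn : Equiv.Perm (Fin n)) :
    let πn := permMatrix σn
    softmax ((Real.sqrt k)⁻¹ • ((πn * Q) * (πn * K)ᵀ) + πn * M * πnᵀ) * (πn * V) =
      πn * (softmax ((Real.sqrt k)⁻¹ • (Q * Kᵀ) + M) * V) := by
  intro πn
  have scores : (Real.sqrt k)⁻¹ • ((πn * Q) * (πn * K)ᵀ) + πn * M * πnᵀ =
      ((Real.sqrt k)⁻¹ • (Q * Kᵀ) + M).submatrix σn σn := by
    simp only [πn, mul_permMatrix_transpose, permMatrix_mul]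
    ext i j
    simp [Matrix.mul_apply]
  rw [scores, softmax_submatrix]
  simp only [πn, permMatrix_mul]
  rw [Matrix.submatrix_mul_equiv]
end
end
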